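/- Let I = (f_1,…,f_n) be a generic ideal of type (n; d_1,…,d_n) in K[x_1,…,x_n] with n ≤ 3 and d_1 ≤ ⋯ ≤ d_n. Then every minimal generator of in(I) satisfies property P with respect to in(I); that is, Conjecture E holds for I. -/

import Mathlib

open MvPolynomial

/-- The total degree of an exponent vector. -/
def expDeg {n : ℕ} (μ : Fin n →₀ ℕ) : ℕ := μ.sum fun _ e => e

/-- Strict degree reverse lexicographic order on exponent vectors, for variables
`x_1 > ⋯ > x_n` (indexed by `Fin n` in this order). -/
def DrlLT {n : ℕ} (a b : Fin n →₀ ℕ) : Prop :=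
  expDeg a < expDeg b ∨
    (expDeg a = expDeg b ∧ ∃ i : Fin n, b i < a i ∧ ∀ j : Fin n, i < j → a j = b j)

/-- `μ` is the leading (degrevlex-largest) exponent of `p`. -/
def IsLeadExp {n : ℕ} {K : Type*} [CommSemiring K] (p : MvPolynomial (Fin n) K)
    (μ : Fin n →₀ ℕ) : Prop :=
  μ ∈ p.support ∧ ∀ ν ∈ p.support, ν ≠ μ → DrlLT ν μ

/-- The initial ideal of `I` with respect to the degree reverse lexicographic order. -/
noncomputable def initialIdeal {n : ℕ} {K : Type*} [CommRing K]
    (I : Ideal (MvPolynomial (Fin n) K)) : Ideal (MvPolynomial (Fin n) K) :=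
  Ideal.span { m | ∃ p ∈ I, p ≠ 0 ∧ ∃ μ, IsLeadExp p μ ∧ m = monomial μ (1 : K) }

/-- The standard monomials of degree `i` of `I` : exponents of the monomials of degree `i`
not lying in the initial ideal of `I`. -/
def stdMon {n : ℕ} {K : Type*} [CommRing K] (I : Ideal (MvPolynomial (Fin n) K)) (i : ℕ) :
    Set (Fin n →₀ ℕ) :=
  { μ | expDeg μ = i ∧ monomial μ (1 : K) ∉ initialIdeal I }

/-- `μ` is a minimal monomial generator of the monomial ideal `M`. -/
def IsMinGen {n : ℕ} {K : Type*} [CommRing K] (M : Ideal (MvPolynomial (Fin n) K))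
    (μ : Fin n →₀ ℕ) : Prop :=
  monomial μ (1 : K) ∈ M ∧ ∀ ν : Fin n →₀ ℕ, ν ≤ μ → ν ≠ μ → monomial ν (1 : K) ∉ M

/-- `μ` satisfies property `P` with respect to the monomial ideal `M`: if `m` is the largest
index of a variable dividing `x^μ`, then every monomial of the same degree in the variables of
index `< m` also lies in `M`. -/
def SatisfiesP {n : ℕ} {K : Type*} [CommRing K] (M : Ideal (MvPolynomial (Fin n) K))
    (μ : Fin n →₀ ℕ) : Prop :=
  ∀ m : Fin n, μ m ≠ 0 → (∀ j : Fin n, m < j → μ j = 0) →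
    ∀ ν : Fin n →₀ ℕ, expDeg ν = expDeg μ → (∀ j : Fin n, m ≤ j → ν j = 0) →
      monomial ν (1 : K) ∈ M

/-- Conjecture E (Pardue) holds for the ideal `I`: every minimal generator of the initial
ideal of `I` satisfies property `P`. -/
def ConjE {n : ℕ} {K : Type*} [CommRing K] (I : Ideal (MvPolynomial (Fin n) K)) : Prop :=
  ∀ μ, IsMinGen (initialIdeal I) μ → SatisfiesP (initialIdeal I) μ

/-- `f` is a generic sequence of forms of degrees `d i` over the base field `F`: each `f i` is
homogeneous of degree `d i` and the family of all coefficients (at all monomials of degree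
`d i`) is algebraically independent over `F`. -/
def IsGenericSeq (F : Type*) {K : Type*} [CommRing F] [CommRing K] [Algebra F K]
    {n r : ℕ} (d : Fin r → ℕ) (f : Fin r → MvPolynomial (Fin n) K) : Prop :=
  (∀ i, (f i).IsHomogeneous (d i)) ∧
    AlgebraicIndependent F
      (fun p : Σ i : Fin r, { μ : Fin n →₀ ℕ // expDeg μ = d i } => (f p.1).coeff p.2.1)

/-- The projection `K[x_1,…,x_n,z] → K[x_1,…,x_n]` sending `z` (the last variable) to `0` and
fixing the other variables. -/
noncomputable def projMap (K : Type*) [CommRing K] (n : ℕ) :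
    MvPolynomial (Fin (n + 1)) K →ₐ[K] MvPolynomial (Fin n) K :=
  aeval (fun i => Fin.lastCases 0 (fun j => X j) i)

/-- Embedding of exponent vectors of `K[x_1,…,x_n]` into those of `K[x_1,…,x_n,z]`
(`z`-exponent `0`). -/
noncomputable def embExp {n : ℕ} (μ : Fin n →₀ ℕ) : Fin (n + 1) →₀ ℕ :=
  Finsupp.embDomain ⟨Fin.castSucc, Fin.castSucc_injective n⟩ μ

/-- Multiplication by `z^c` on exponent vectors in `K[x_1,…,x_n,z]`. -/
noncomputable def zShift {n : ℕ} (c : ℕ) (μ : Fin (n + 1) →₀ ℕ) : Fin (n + 1) →₀ ℕ :=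
  μ + Finsupp.single (Fin.last n) c

/-- `f` (homogeneous of degree `e`) is semi-regular on `R/I`: in each degree `t`, the
multiplication map `(R/I)_t → (R/I)_{t+e}` is injective or surjective. -/
def SemiRegularOn {vars K : Type*} [CommRing K] (I : Ideal (MvPolynomial vars K))
    (f : MvPolynomial vars K) (e : ℕ) : Prop :=
  ∀ t : ℕ,
    (∀ p ∈ homogeneousSubmodule vars K t, f * p ∈ I → p ∈ I) ∨
    (∀ q ∈ homogeneousSubmodule vars K (t + e),
      ∃ p ∈ homogeneousSubmodule vars K t, q - f * p ∈ I)

/-- The degree-`t` graded piece of `R/I`, as a `K`-submodule of the quotient. -/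
noncomputable def quotDegPart {vars K : Type*} [CommRing K] (I : Ideal (MvPolynomial vars K))
    (t : ℕ) : Submodule K (MvPolynomial vars K ⧸ I) :=
  (homogeneousSubmodule vars K t).map (Ideal.Quotient.mkₐ K I).toLinearMap

open Polynomial in
theorem det_genericBandMatrix_ne_zero {F K : Type*} [Field F] [Field K] [Algebra F K]
    {ι : Type*} [DecidableEq ι] {d : ι → ℕ} {g : ι → K[X]}
    (hdeg : ∀ i k, d i < k → (g i).coeff k = 0)
    (hg : AlgebraicIndependent F (fun p : Σ i, Fin (d i + 1) => (g p.1).coeff p.2))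
    {s : ι → ℕ} (hs : ∀ i, s i ≤ d i) (T : Finset (ι × ℕ))
    (hT : Set.InjOn (fun t : ι × ℕ => t.2 + s t.1) T) :
    (Matrix.of fun t t' : T =>
      (Polynomial.X ^ t'.1.2 * g t'.1.1).coeff (t.1.2 + s t.1.1)).det ≠ 0 := by
  classical
  let M : Matrix T T (MvPolynomial (Σ i, Fin (d i + 1)) F) := Matrix.of fun t t' =>
    if h : t'.1.2 ≤ t.1.2 + s t.1.1 ∧ t.1.2 + s t.1.1 - t'.1.2 < d t'.1.1 + 1 then
      MvPolynomial.X ⟨t'.1.1, ⟨t.1.2 + s t.1.1 - t'.1.2, h.2⟩⟩ else 0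
  let φ : MvPolynomial (Σ i, Fin (d i + 1)) F →+* F :=
    MvPolynomial.eval fun p => if (p.2 : ℕ) = s p.1 then 1 else 0
  have h1 : φ.mapMatrix M = 1 := by
    ext t t'
    simp only [RingHom.mapMatrix_apply, Matrix.map_apply, M, Matrix.of_apply, Matrix.one_apply]
    have key : t.1.2 + s t.1.1 = t'.1.2 + s t'.1.1 ↔ t = t' :=
      ⟨fun h => Subtype.ext (hT t.2 t'.2 h), fun h => by rw [h]⟩
    have := hs t'.1.1
    split_ifs with h h' h'
    · subst h'
      simp [φ]
    · simp only [φ, MvPolynomial.eval_X]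
      rw [if_neg]
      intro h2
      exact h' (key.1 (by omega))
    · subst h'
      exact absurd ⟨by omega, by omega⟩ h
    · simp
  have h2 : M.det ≠ 0 := by
    intro h
    have := congrArg φ h
    rw [RingHom.map_det, h1] at this
    simp at this
  let ψ := MvPolynomial.aeval (R := F) (fun p : Σ i, Fin (d i + 1) => (g p.1).coeff p.2)
  have h3 : (Matrix.of fun t t' : T => (Polynomial.X ^ t'.1.2 * g t'.1.1).coeff (t.1.2 + s t.1.1)) =
      ψ.toRingHom.mapMatrix M := by
    ext t t'
    simp only [RingHom.mapMatrix_apply, Matrix.map_apply, M, Matrix.of_apply,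
      Polynomial.coeff_X_pow_mul']
    split_ifs with h h' h'
    · simp [ψ]
    · rw [hdeg _ _ (by omega)]; simp
    · exact absurd h'.1 h
    · simp
  rw [h3, ← RingHom.map_det]
  intro h
  exact h2 (hg (by simpa using h))

open Polynomial in
theorem exists_coeff_eq_of_generic {F K : Type*} [Field F] [Field K] [Algebra F K]
    {ι : Type*} [Fintype ι] [DecidableEq ι] {d : ι → ℕ} {g : ι → K[X]}
    (hdeg : ∀ i k, d i < k → (g i).coeff k = 0)
    (hg : AlgebraicIndependent F (fun p : Σ i, Fin (d i + 1) => (g p.1).coeff p.2))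
    {s : ι → ℕ} (hs : ∀ i, s i ≤ d i) (T : Finset (ι × ℕ))
    (hT : Set.InjOn (fun t : ι × ℕ => t.2 + s t.1) T) (a : K[X]) :
    ∃ u : ι → K[X], (∀ i k, (i, k) ∉ T → (u i).coeff k = 0) ∧
      ∀ t ∈ T, (∑ i, u i * g i).coeff (t.2 + s t.1) = a.coeff (t.2 + s t.1) := by
  classical
  have hdet := det_genericBandMatrix_ne_zero hdeg hg hs T hT
  set M := Matrix.of fun t t' : T => (Polynomial.X ^ t'.1.2 * g t'.1.1).coeff (t.1.2 + s t.1.1)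
  obtain ⟨c, hc⟩ := (Matrix.mulVec_surjective_iff_isUnit.2
    ((Matrix.isUnit_iff_isUnit_det _).2 (isUnit_iff_ne_zero.2 hdet)))
    (fun t : T => a.coeff (t.1.2 + s t.1.1))
  refine ⟨fun i => ∑ t : T,
    if t.1.1 = i then Polynomial.C (c t) * Polynomial.X ^ t.1.2 else 0, fun i k hk => ?_,
    fun t ht => ?_⟩
  · rw [Polynomial.finsetSum_coeff]
    refine Finset.sum_eq_zero fun t _ => ?_
    split_ifs with h
    · rw [Polynomial.coeff_C_mul_X_pow, if_neg]
      rintro rfl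
      exact hk (h ▸ t.2)
    · simp
  · rw [← congrFun hc ⟨t, ht⟩]
    simp only [Finset.sum_mul, ite_mul, zero_mul]
    rw [Finset.sum_comm]
    simp only [Finset.sum_ite_eq, Finset.mem_univ, if_true, Polynomial.finsetSum_coeff, Matrix.mulVec,
      dotProduct, M, Matrix.of_apply, mul_assoc, Polynomial.coeff_C_mul]
    exact Finset.sum_congr rfl fun _ _ => mul_comm _ _

open Polynomial in
theorem eq_zero_of_generic {F K : Type*} [Field F] [Field K] [Algebra F K]
    {ι : Type*} [Fintype ι] [DecidableEq ι] {d : ι → ℕ} {g : ι → K[X]}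
    (hdeg : ∀ i k, d i < k → (g i).coeff k = 0)
    (hg : AlgebraicIndependent F (fun p : Σ i, Fin (d i + 1) => (g p.1).coeff p.2))
    {s : ι → ℕ} (hs : ∀ i, s i ≤ d i) (T : Finset (ι × ℕ))
    (hT : Set.InjOn (fun t : ι × ℕ => t.2 + s t.1) T) (u : ι → K[X])
    (hu : ∀ i k, (i, k) ∉ T → (u i).coeff k = 0) (h0 : ∑ i, u i * g i = 0) (i : ι) :
    u i = 0 := by
  classical
  have hdet := det_genericBandMatrix_ne_zero hdeg hg hs T hT
  have hui : ∀ i, u i = ∑ t : T,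
      if t.1.1 = i then Polynomial.C ((u i).coeff t.1.2) * Polynomial.X ^ t.1.2 else 0 := by
    intro i
    ext k
    rw [Polynomial.finsetSum_coeff]
    by_cases hk : (i, k) ∈ T
    · rw [Finset.sum_eq_single ⟨(i, k), hk⟩]
      · simp
      · rintro ⟨⟨i', k'⟩, ht⟩ _ hne
        split_ifs with h
        · subst h
          rw [Polynomial.coeff_C_mul_X_pow, if_neg]
          rintro rfl
          exact hne rfl
        · simp
      · simp
    · rw [hu i k hk, Finset.sum_eq_zero]
      rintro ⟨⟨i', k'⟩, ht⟩ _
      split_ifs with h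
      · subst h
        rw [Polynomial.coeff_C_mul_X_pow, if_neg]
        rintro rfl
        exact hk ht
      · simp
  have hz := Matrix.eq_zero_of_mulVec_eq_zero hdet (v := fun t : T => (u t.1.1).coeff t.1.2) (by
    ext t
    simp only [Matrix.mulVec, dotProduct, Matrix.of_apply, Pi.zero_apply]
    have h1 : ∑ i, u i * g i =
        ∑ t : T, Polynomial.C ((u t.1.1).coeff t.1.2) * (Polynomial.X ^ t.1.2 * g t.1.1) := by
      rw [Finset.sum_congr rfl fun i _ => by rw [hui i]]
      simp only [Finset.sum_mul, ite_mul, zero_mul]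
      rw [Finset.sum_comm]
      refine Finset.sum_congr rfl fun t _ => ?_
      simp [mul_assoc]
    have h2 := congrArg (fun p => p.coeff (t.1.2 + s t.1.1)) (h1.symm.trans h0)
    simp only [Polynomial.finsetSum_coeff, Polynomial.coeff_C_mul, Polynomial.coeff_zero] at h2
    rw [← h2]
    exact Finset.sum_congr rfl fun _ _ => mul_comm _ _)
  ext k
  by_cases hk : (i, k) ∈ T
  · exact congrFun hz ⟨(i, k), hk⟩
  · rw [hu i k hk, Polynomial.coeff_zero]

/-- Every exponent `k` occurring in `u` satisfies `k + e ≤ D`; for `e ≤ D` this says that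
`u` has degree at most `D - e`, and otherwise that `u = 0`. -/
def DegAddLE {K : Type*} [Semiring K] (D e : ℕ) (u : Polynomial K) : Prop :=
  ∀ k, D < k + e → u.coeff k = 0

theorem DegAddLE.add {K : Type*} [Semiring K] {D e : ℕ} {u v : Polynomial K}
    (hu : DegAddLE D e u) (hv : DegAddLE D e v) : DegAddLE D e (u + v) := fun k hk => by
  rw [Polynomial.coeff_add, hu k hk, hv k hk, add_zero]

theorem DegAddLE.neg {K : Type*} [Ring K] {D e : ℕ} {u : Polynomial K}
    (hu : DegAddLE D e u) : DegAddLE D e (-u) := fun k hk => by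
  rw [Polynomial.coeff_neg, hu k hk, neg_zero]

theorem DegAddLE.sub {K : Type*} [Ring K] {D e : ℕ} {u v : Polynomial K}
    (hu : DegAddLE D e u) (hv : DegAddLE D e v) : DegAddLE D e (u - v) := by
  rw [sub_eq_add_neg]; exact hu.add hv.neg

theorem DegAddLE.mul {K : Type*} [Semiring K] {D e d e' : ℕ} {u g : Polynomial K}
    (hu : DegAddLE D e' u) (hg : ∀ k, d < k → g.coeff k = 0) (he : e' = e + d) :
    DegAddLE D e (u * g) := fun k hk => by
  rw [Polynomial.coeff_mul]
  refine Finset.sum_eq_zero fun p hp => ?_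
  rw [Finset.HasAntidiagonal.mem_antidiagonal] at hp
  by_cases h : d < p.2
  · rw [hg _ h, mul_zero]
  · rw [hu _ (by omega), zero_mul]

open Classical in
/-- The pairs `(i, k)` with `k ≤ D` satisfying `P`. -/
noncomputable def boundedPairs {ι : Type*} [Fintype ι] (D : ℕ) (P : ι → ℕ → Prop) :
    Finset (ι × ℕ) :=
  (Finset.univ ×ˢ Finset.range (D + 1)).filter fun t => P t.1 t.2

theorem mem_boundedPairs {ι : Type*} [Fintype ι] {D : ℕ} {P : ι → ℕ → Prop} {i : ι} {k : ℕ} :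
    (i, k) ∈ boundedPairs D P ↔ k ≤ D ∧ P i k := by
  simp [boundedPairs]

/-- Three generic forms in two variables (dehomogenized) satisfy the following in each degree:
either they generate everything, or all their syzygies are Koszul. -/
theorem surjective_or_koszul_of_generic {F K : Type*} [Field F] [Field K] [Algebra F K]
    {d : Fin 3 → ℕ} {g : Fin 3 → Polynomial K}
    (hdeg : ∀ i k, d i < k → (g i).coeff k = 0)
    (hg : AlgebraicIndependent F (fun p : Σ i, Fin (d i + 1) => (g p.1).coeff p.2)) (D : ℕ) :
    (∀ h : Polynomial K, DegAddLE D 0 h → ∃ u : Fin 3 → Polynomial K,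
      (∀ i, DegAddLE D (d i) (u i)) ∧ ∑ i, u i * g i = h) ∨
    (∀ u : Fin 3 → Polynomial K, (∀ i, DegAddLE D (d i) (u i)) → ∑ i, u i * g i = 0 →
      ∃ v w r : Polynomial K, DegAddLE D (d 0 + d 1) v ∧ DegAddLE D (d 0 + d 2) w ∧
        DegAddLE D (d 1 + d 2) r ∧ u 0 = v * g 1 + w * g 2 ∧ u 1 = -v * g 0 + r * g 2 ∧
        u 2 = -w * g 0 - r * g 1) := by
  let κ := (D + 1 - d 1) - (D + 1 - d 1 - d 2)
  have hκ : κ = (D + 1 - d 1) - (D + 1 - d 1 - d 2) := rfl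
  clear_value κ
  have hs : ∀ i, (![d 0, 0, κ] : Fin 3 → ℕ) i ≤ d i := by
    intro i
    fin_cases i <;> simp; omega
  by_cases hinj : ∀ k, k + d 2 ≤ D → k < d 0 → D < k + d 1 + d 2 → k + κ < d 0
  · right
    intro u hu h0
    -- reduce the last component modulo `g 0` and `g 1`
    obtain ⟨a, ha, haT⟩ := exists_coeff_eq_of_generic hdeg hg hs
      (boundedPairs D fun i k => (i = 0 ∧ k + d 0 + d 2 ≤ D) ∨ (i = 1 ∧ k < d 0 ∧ k + d 1 + d 2 ≤ D))
      (by
        rintro ⟨i, k⟩ h ⟨i', k'⟩ h' he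
        rw [Finset.mem_coe, mem_boundedPairs] at h h'
        fin_cases i <;> fin_cases i' <;> simp at h h' he ⊢ <;> omega) (u 2)
    simp only [mem_boundedPairs] at ha
    have ha2 : a 2 = 0 := by
      ext k
      rw [ha 2 k (by simp), Polynomial.coeff_zero]
    have ha0 : DegAddLE D (d 0 + d 2) (a 0) := fun k hk => ha 0 k (by simp; omega)
    have ha1 : DegAddLE D (d 1 + d 2) (a 1) := fun k hk => ha 1 k (by simp; omega)
    simp only [Fin.sum_univ_three, ha2, zero_mul, add_zero] at haT
    -- reduce the middle component modulo `g 0`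
    obtain ⟨b, hb, hbT⟩ := exists_coeff_eq_of_generic hdeg hg hs
      (boundedPairs D fun i k => i = 0 ∧ k + d 0 + d 1 ≤ D)
      (by
        rintro ⟨i, k⟩ h ⟨i', k'⟩ h' he
        rw [Finset.mem_coe, mem_boundedPairs] at h h'
        fin_cases i <;> fin_cases i' <;> simp at h h' he ⊢; omega) (u 1 + a 1 * g 2)
    simp only [mem_boundedPairs] at hb
    have hb1 : b 1 = 0 := by
      ext k
      rw [hb 1 k (by simp), Polynomial.coeff_zero]
    have hb2 : b 2 = 0 := by
      ext k
      rw [hb 2 k (by simp), Polynomial.coeff_zero]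
    have hb0 : DegAddLE D (d 0 + d 1) (b 0) := fun k hk => hb 0 k (by simp; omega)
    simp only [Fin.sum_univ_three, hb1, hb2, zero_mul, add_zero] at hbT
    -- the reduced syzygy vanishes
    have hz := eq_zero_of_generic hdeg hg hs
      (boundedPairs D fun i k => (i = 0 ∧ k + d 0 ≤ D) ∨ (i = 1 ∧ k < d 0 ∧ k + d 1 ≤ D) ∨
        (i = 2 ∧ k + d 2 ≤ D ∧ k < d 0 ∧ D < k + d 1 + d 2))
      (by
        rintro ⟨i, k⟩ h ⟨i', k'⟩ h' he
        rw [Finset.mem_coe, mem_boundedPairs] at h h'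
        have := hinj k
        have := hinj k'
        fin_cases i <;> fin_cases i' <;> simp at h h' he ⊢ <;> omega)
      ![u 0 + a 0 * g 2 + b 0 * g 1, u 1 + a 1 * g 2 - b 0 * g 0,
        u 2 - a 0 * g 0 - a 1 * g 1]
      (by
        intro i k hk
        rw [mem_boundedPairs] at hk
        fin_cases i
        · exact (((hu 0).add (ha0.mul (hdeg 2) rfl)).add (hb0.mul (hdeg 1) rfl)) k
            (by simp at hk; omega)
        · by_cases hkD : D < k + d 1
          · exact (((hu 1).add (ha1.mul (hdeg 2) rfl)).sub
              (hb0.mul (hdeg 0) (add_comm _ _))) k hkD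
          · have h1 : d 0 ≤ k := by
              by_contra h1
              exact hk ⟨by omega, by simp; omega⟩
            have h2 := hbT (0, k - d 0) (mem_boundedPairs.2 ⟨by omega, by simp; omega⟩)
            simp only [Matrix.cons_val_zero, Nat.sub_add_cancel h1] at h2
            simp [h2]
        · by_cases hkD : D < k + d 2
          · exact (((hu 2).sub (ha0.mul (hdeg 0) (add_comm _ _))).sub
              (ha1.mul (hdeg 1) (add_comm _ _))) k hkD
          · have h2 : (a 0 * g 0 + a 1 * g 1).coeff k = (u 2).coeff k := by
              by_cases h1 : d 0 ≤ k
              · have h2 := haT (0, k - d 0) (mem_boundedPairs.2 ⟨by omega, by simp; omega⟩)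
                simpa only [Matrix.cons_val_zero, Nat.sub_add_cancel h1] using h2
              · have h3 : k + d 1 + d 2 ≤ D := by
                  by_contra h3
                  exact hk ⟨by omega, by simp; omega⟩
                exact haT (1, k) (mem_boundedPairs.2 ⟨by omega, by simp; omega⟩)
            rw [Polynomial.coeff_add] at h2
            simp [← h2])
      (by
        rw [← h0]
        simp only [Fin.sum_univ_three, Matrix.cons_val_zero, Matrix.cons_val_one,
          Matrix.cons_val]
        ring)
    have hz0 := hz 0
    have hz1 := hz 1
    have hz2 := hz 2
    simp only [Matrix.cons_val_zero, Matrix.cons_val_one, Matrix.cons_val] at hz0 hz1 hz2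
    exact ⟨-b 0, -a 0, -a 1, hb0.neg, ha0.neg, ha1.neg, by linear_combination hz0,
      by linear_combination hz1, by linear_combination hz2⟩
  · left
    push Not at hinj
    obtain ⟨k₀, h1, h2, h3, h4⟩ := hinj
    intro h hh
    obtain ⟨a, ha, haT⟩ := exists_coeff_eq_of_generic hdeg hg hs
      (boundedPairs D fun i k => (i = 0 ∧ k + d 0 ≤ D) ∨ (i = 1 ∧ k < d 0 ∧ k + d 1 ≤ D) ∨
        (i = 2 ∧ k + d 2 ≤ D ∧ k + κ < d 0 ∧ D < k + κ + d 1))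
      (by
        rintro ⟨i, k⟩ h ⟨i', k'⟩ h' he
        rw [Finset.mem_coe, mem_boundedPairs] at h h'
        fin_cases i <;> fin_cases i' <;> simp at h h' he ⊢ <;> omega) h
    simp only [mem_boundedPairs] at ha
    have had : ∀ i, DegAddLE D (d i) (a i) := by
      intro i k hk
      refine ha i k ?_
      fin_cases i <;> simp at hk ⊢ <;> omega
    refine ⟨a, had, ?_⟩
    ext k
    by_cases hkD : D < k
    · rw [hh k hkD]
      have hsum : DegAddLE D 0 (∑ i, a i * g i) := by
        rw [Fin.sum_univ_three]
        exact (((had 0).mul (hdeg 0) (zero_add _).symm).add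
          ((had 1).mul (hdeg 1) (zero_add _).symm)).add ((had 2).mul (hdeg 2) (zero_add _).symm)
      exact hsum k hkD
    · by_cases hk0 : d 0 ≤ k
      · have := haT (0, k - d 0) (mem_boundedPairs.2 ⟨by omega, by simp; omega⟩)
        simpa only [Matrix.cons_val_zero, Nat.sub_add_cancel hk0] using this
      · by_cases hk1 : k + d 1 ≤ D
        · exact haT (1, k) (mem_boundedPairs.2 ⟨by omega, by simp; omega⟩)
        · have hκk : κ ≤ k := by omega
          have := haT (2, k - κ) (mem_boundedPairs.2 ⟨by omega, by simp; omega⟩)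
          simpa only [Matrix.cons_val, Nat.sub_add_cancel hκk] using this

theorem expDeg_add {n : ℕ} (μ ν : Fin n →₀ ℕ) : expDeg (μ + ν) = expDeg μ + expDeg ν :=
  map_add Finsupp.degree μ ν

theorem expDeg_single {n : ℕ} (i : Fin n) (k : ℕ) : expDeg (Finsupp.single i k) = k :=
  Finsupp.sum_single_index rfl

theorem expDeg_eq_sum {n : ℕ} (μ : Fin n →₀ ℕ) : expDeg μ = ∑ i, μ i :=
  Finsupp.sum_fintype _ _ fun _ => rfl

theorem MvPolynomial.IsHomogeneous.coeff_eq_zero_of_expDeg_ne {n : ℕ} {K : Type*} [CommSemiring K]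
    {p : MvPolynomial (Fin n) K} {e : ℕ} (hp : p.IsHomogeneous e) {μ : Fin n →₀ ℕ}
    (hμ : expDeg μ ≠ e) : p.coeff μ = 0 :=
  hp.coeff_eq_zero hμ

/-- Every exponent `μ` occurring in `p` satisfies `|μ| + e = D`; for `e ≤ D` this says that `p` is
homogeneous of degree `D - e`, and otherwise that `p = 0`. -/
def HomogAdd {n : ℕ} {K : Type*} [CommSemiring K] (D e : ℕ) (p : MvPolynomial (Fin n) K) : Prop :=
  ∀ μ, expDeg μ + e ≠ D → p.coeff μ = 0

section HomogAdd

variable {n : ℕ} {K : Type*} [CommRing K] {D e : ℕ} {p q : MvPolynomial (Fin n) K}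

theorem HomogAdd.add (hp : HomogAdd D e p) (hq : HomogAdd D e q) : HomogAdd D e (p + q) :=
  fun μ hμ => by rw [coeff_add, hp μ hμ, hq μ hμ, add_zero]

theorem HomogAdd.sub (hp : HomogAdd D e p) (hq : HomogAdd D e q) : HomogAdd D e (p - q) :=
  fun μ hμ => by rw [coeff_sub, hp μ hμ, hq μ hμ, sub_zero]

theorem HomogAdd.mul {d e' : ℕ} (hp : HomogAdd D e' p) (hq : q.IsHomogeneous d)
    (he : e' = e + d) : HomogAdd D e (p * q) := fun μ hμ => by
  rw [coeff_mul]
  refine Finset.sum_eq_zero fun x hx => ?_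
  rw [Finset.HasAntidiagonal.mem_antidiagonal] at hx
  by_cases h : expDeg x.2 = d
  · rw [hp, zero_mul]
    rw [← hx, expDeg_add] at hμ
    omega
  · rw [hq.coeff_eq_zero_of_expDeg_ne h, mul_zero]

theorem MvPolynomial.IsHomogeneous.homogAdd (hp : p.IsHomogeneous D) : HomogAdd D 0 p :=
  fun _ hμ => hp.coeff_eq_zero_of_expDeg_ne hμ

/-- The homogeneous component of degree `D` of a member of an ideal generated by forms is
a combination of these forms with homogeneous coefficients. -/
theorem exists_homogAdd_of_mem_span {r : ℕ} {d : Fin r → ℕ} {f : Fin r → MvPolynomial (Fin n) K}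
    (hf : ∀ i, (f i).IsHomogeneous (d i)) (hp : p ∈ Ideal.span (Set.range f)) (D : ℕ) :
    ∃ a : Fin r → MvPolynomial (Fin n) K, (∀ i, HomogAdd D (d i) (a i)) ∧
      homogeneousComponent D p = ∑ i, a i * f i := by
  obtain ⟨c, rfl⟩ := Ideal.mem_span_range_iff_exists_fun.1 hp
  refine ⟨fun i => if d i ≤ D then homogeneousComponent (D - d i) (c i) else 0,
    fun i μ hμ => ?_, ?_⟩
  · dsimp only
    split_ifs with h
    · rw [coeff_homogeneousComponent, if_neg]
      change ¬ expDeg μ = _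
      omega
    · exact coeff_zero _
  · rw [map_sum]
    refine Finset.sum_congr rfl fun i _ => ?_
    ext μ
    rw [coeff_homogeneousComponent, coeff_mul, coeff_mul, ← Finset.sum_const_zero,
      ← Finset.sum_ite_irrel]
    refine Finset.sum_congr rfl fun x hx => ?_
    rw [Finset.HasAntidiagonal.mem_antidiagonal] at hx
    by_cases hxd : expDeg x.2 = d i
    · have hμ : Finsupp.degree μ = expDeg x.1 + d i := by
        rw [← hx, ← hxd]
        exact expDeg_add _ _
      rw [hμ]
      by_cases hiD : d i ≤ D
      · have h1 : expDeg x.1 + d i = D ↔ Finsupp.degree x.1 = D - d i := by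
          change _ ↔ expDeg x.1 = _
          omega
        simp [hiD, coeff_homogeneousComponent, h1]
      · rw [if_neg (by omega)]
        simp [hiD]
    · simp [(hf i).coeff_eq_zero_of_expDeg_ne hxd]

end HomogAdd

theorem X_dvd_of_coeff_eq_zero {n : ℕ} {K : Type*} [CommRing K] {i : Fin n}
    {p : MvPolynomial (Fin n) K} (h : ∀ μ : Fin n →₀ ℕ, μ i = 0 → p.coeff μ = 0) : X i ∣ p := by
  rw [X_dvd_iff_modMonomial_eq_zero]
  ext μ
  by_cases hμ : Finsupp.single i 1 ≤ μ
  · rw [coeff_modMonomial_of_le _ hμ, coeff_zero]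
  · rw [coeff_modMonomial_of_not_le _ hμ, coeff_zero]
    apply h
    by_contra h0
    exact hμ (Finsupp.single_le_iff.2 (Nat.one_le_iff_ne_zero.2 h0))

/-- The exponent vector of the monomial `x^a y^b`. -/
noncomputable def planeExp (a b : ℕ) : Fin 3 →₀ ℕ :=
  Finsupp.equivFunOnFinite.symm ![a, b, 0]

theorem expDeg_planeExp (a b : ℕ) : expDeg (planeExp a b) = a + b := by
  simp [expDeg_eq_sum, planeExp, Fin.sum_univ_three]

/-- The substitution `x ↦ X`, `y ↦ 1`, `z ↦ 0`. -/
noncomputable def planeDehom (K : Type*) [CommRing K] :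
    MvPolynomial (Fin 3) K →ₐ[K] Polynomial K :=
  aeval ![Polynomial.X, 1, 0]

section Plane

variable {K : Type*} [CommRing K] {D e : ℕ}

theorem coeff_planeDehom {p : MvPolynomial (Fin 3) K} (hp : HomogAdd D e p) (l : ℕ) :
    (planeDehom K p).coeff l = if l + e ≤ D then p.coeff (planeExp l (D - e - l)) else 0 := by
  classical
  have h1 : (planeDehom K p).coeff l =
      ∑ μ ∈ p.support, if μ 2 = 0 ∧ μ 0 = l then p.coeff μ else 0 := by
    rw [planeDehom, aeval_def, eval₂_eq', Polynomial.finsetSum_coeff]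
    refine Finset.sum_congr rfl fun μ _ => ?_
    by_cases h2 : μ 2 = 0
    · simp [Fin.prod_univ_three, Polynomial.algebraMap_eq, h2, Polynomial.coeff_X_pow, eq_comm]
    · simp [Fin.prod_univ_three, h2]
  rw [h1]
  split_ifs with hl
  · have h2 : ∀ μ ∈ p.support, (if μ 2 = 0 ∧ μ 0 = l then p.coeff μ else 0) =
        if μ = planeExp l (D - e - l) then p.coeff μ else 0 := by
      intro μ hμ
      have hd : expDeg μ + e = D := by
        by_contra h
        exact mem_support_iff.1 hμ (hp μ h)
      rw [expDeg_eq_sum, Fin.sum_univ_three] at hd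
      refine if_congr ⟨fun h => ?_, fun h => ?_⟩ rfl rfl
      · ext i
        fin_cases i <;> simp [planeExp] <;> omega
      · subst h
        simp [planeExp]
    rw [Finset.sum_congr rfl h2, Finset.sum_ite_eq']
    simp +contextual [eq_comm]
  · refine Finset.sum_eq_zero fun μ hμ => if_neg fun h => ?_
    have hd : expDeg μ + e = D := by
      by_contra h
      exact mem_support_iff.1 hμ (hp μ h)
    rw [expDeg_eq_sum, Fin.sum_univ_three] at hd
    omega

theorem degAddLE_planeDehom {p : MvPolynomial (Fin 3) K} (hp : HomogAdd D e p) :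
    DegAddLE D e (planeDehom K p) := fun l hl => by
  rw [coeff_planeDehom hp, if_neg (by omega)]

theorem X_dvd_of_planeDehom_eq_zero {p : MvPolynomial (Fin 3) K} (hp : HomogAdd D e p)
    (h0 : planeDehom K p = 0) : X 2 ∣ p := by
  refine X_dvd_of_coeff_eq_zero fun μ hμ => ?_
  by_cases hd : expDeg μ + e = D
  · have h1 := coeff_planeDehom hp (μ 0)
    rw [expDeg_eq_sum, Fin.sum_univ_three] at hd
    rw [h0, Polynomial.coeff_zero, if_pos (by omega)] at h1
    rw [h1]
    congr 1
    ext i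
    fin_cases i <;> simp [planeExp] <;> omega
  · exact hp μ hd

theorem exists_planeDehom_eq {v : Polynomial K} (hv : DegAddLE D e v) :
    ∃ p : MvPolynomial (Fin 3) K, HomogAdd D e p ∧ planeDehom K p = v := by
  classical
  have hp : HomogAdd D e (∑ k ∈ (Finset.range (D + 1)).filter fun k => k + e ≤ D,
      monomial (planeExp k (D - e - k)) (v.coeff k)) := by
    intro μ hμ
    rw [coeff_sum]
    refine Finset.sum_eq_zero fun k hk => ?_
    rw [coeff_monomial, if_neg]
    rintro rfl
    rw [expDeg_planeExp] at hμ
    rw [Finset.mem_filter] at hk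
    omega
  refine ⟨_, hp, ?_⟩
  ext l
  rw [coeff_planeDehom hp]
  split_ifs with hl
  · rw [coeff_sum, Finset.sum_eq_single l]
    · rw [coeff_monomial, if_pos rfl]
    · intro k _ hk
      rw [coeff_monomial, if_neg]
      intro h
      exact hk (by simpa [planeExp] using DFunLike.congr_fun h 0)
    · intro h
      exact (h (Finset.mem_filter.2 ⟨Finset.mem_range.2 (by omega), hl⟩)).elim
  · rw [hv l (by omega)]

end Plane

/-- In each degree `D`, either `z` and three generic forms generate all forms of degree `D`,
or multiplication by `z` into degree `D` is injective modulo the three forms. -/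
theorem surjective_or_injective_of_isGenericSeq {F K : Type*} [Field F] [Field K] [Algebra F K]
    {d : Fin 3 → ℕ} {f : Fin 3 → MvPolynomial (Fin 3) K} (hf : IsGenericSeq F d f) (D : ℕ) :
    (∀ h : MvPolynomial (Fin 3) K, HomogAdd D 0 h →
      ∃ p ∈ Ideal.span (Set.range f), HomogAdd D 0 p ∧ X 2 ∣ h - p) ∨
    (∀ q : MvPolynomial (Fin 3) K, HomogAdd D 0 (X 2 * q) →
      X 2 * q ∈ Ideal.span (Set.range f) → q ∈ Ideal.span (Set.range f)) := by
  have hmem : ∀ i, f i ∈ Ideal.span (Set.range f) := fun i => Ideal.subset_span ⟨i, rfl⟩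
  have hdeg : ∀ i k, d i < k → (planeDehom K (f i)).coeff k = 0 := fun i k hk =>
    degAddLE_planeDehom (hf.1 i).homogAdd k (by omega)
  have hg : AlgebraicIndependent F
      (fun p : Σ i, Fin (d i + 1) => (planeDehom K (f p.1)).coeff p.2) := by
    have h1 := hf.2.comp (fun p : Σ i, Fin (d i + 1) =>
      ⟨p.1, ⟨planeExp p.2 (d p.1 - p.2), by rw [expDeg_planeExp]; omega⟩⟩) (by
        rintro ⟨i, k⟩ ⟨i', k'⟩ h
        obtain rfl : i = i' := congrArg Sigma.fst h
        have h2 := congrArg (fun v : Fin 3 →₀ ℕ => v 0)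
          (congrArg Subtype.val (eq_of_heq (Sigma.mk.inj h).2))
        simp only [planeExp, Finsupp.coe_equivFunOnFinite_symm, Matrix.cons_val_zero] at h2
        rw [Fin.ext h2])
    convert h1 using 2 with p
    rw [coeff_planeDehom (hf.1 p.1).homogAdd, if_pos (by omega)]
    rfl
  have hX : planeDehom K (X 2) = 0 := by simp [planeDehom]
  rcases surjective_or_koszul_of_generic hdeg hg D with hs | hk
  · left
    intro h hh
    obtain ⟨u, hu, hsum⟩ := hs _ (degAddLE_planeDehom hh)
    choose a ha hau using fun i => exists_planeDehom_eq (hu i)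
    have hp : HomogAdd D 0 (∑ i, a i * f i) := by
      rw [Fin.sum_univ_three]
      exact (((ha 0).mul (hf.1 0) (zero_add _).symm).add
        ((ha 1).mul (hf.1 1) (zero_add _).symm)).add ((ha 2).mul (hf.1 2) (zero_add _).symm)
    refine ⟨_, Ideal.sum_mem _ fun i _ => Ideal.mul_mem_left _ (a i) (hmem i), hp,
      X_dvd_of_planeDehom_eq_zero (hh.sub hp) ?_⟩
    simp [map_sum, hau, hsum]
  · right
    intro q hq hqI
    obtain ⟨a, ha, hsum⟩ := exists_homogAdd_of_mem_span hf.1 hqI D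
    have hqD : homogeneousComponent D (X 2 * q) = X 2 * q := by
      ext μ
      rw [coeff_homogeneousComponent]
      split_ifs with h
      · rfl
      · exact (hq μ h).symm
    rw [hqD, Fin.sum_univ_three] at hsum
    obtain ⟨v, w, r, hv, hw, hr, h0, h1, h2⟩ := hk (fun i => planeDehom K (a i))
      (fun i => degAddLE_planeDehom (ha i)) (by
        have := congrArg (planeDehom K) hsum
        rw [map_mul, hX, zero_mul] at this
        simpa [Fin.sum_univ_three] using this.symm)
    obtain ⟨v, hv', rfl⟩ := exists_planeDehom_eq hv
    obtain ⟨w, hw', rfl⟩ := exists_planeDehom_eq hw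
    obtain ⟨r, hr', rfl⟩ := exists_planeDehom_eq hr
    obtain ⟨b0, hb0⟩ := X_dvd_of_planeDehom_eq_zero
      (((ha 0).sub (hv'.mul (hf.1 1) rfl)).sub (hw'.mul (hf.1 2) rfl))
      (by simp [h0])
    obtain ⟨b1, hb1⟩ := X_dvd_of_planeDehom_eq_zero
      (((ha 1).add (hv'.mul (hf.1 0) (add_comm _ _))).sub (hr'.mul (hf.1 2) rfl))
      (by simp [h1])
    obtain ⟨b2, hb2⟩ := X_dvd_of_planeDehom_eq_zero
      (((ha 2).add (hw'.mul (hf.1 0) (add_comm _ _))).add (hr'.mul (hf.1 1) (add_comm _ _)))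
      (by simp only [map_add, map_mul, h2]; ring)
    have hqe : q = b0 * f 0 + b1 * f 1 + b2 * f 2 := by
      refine mul_left_cancel₀ (X_ne_zero (R := K) (2 : Fin 3)) ?_
      linear_combination hsum + f 0 * hb0 + f 1 * hb1 + f 2 * hb2
    rw [hqe]
    exact Ideal.add_mem _ (Ideal.add_mem _ (Ideal.mul_mem_left _ _ (hmem 0))
      (Ideal.mul_mem_left _ _ (hmem 1))) (Ideal.mul_mem_left _ _ (hmem 2))

theorem monomial_mem_initialIdeal_iff {n : ℕ} {K : Type*} [Field K]
    {I : Ideal (MvPolynomial (Fin n) K)} {ν : Fin n →₀ ℕ} :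
    monomial ν (1 : K) ∈ initialIdeal I ↔ ∃ μ ≤ ν, ∃ p ∈ I, IsLeadExp p μ := by
  have hset : { m | ∃ p ∈ I, p ≠ 0 ∧ ∃ μ, IsLeadExp p μ ∧ m = monomial μ (1 : K) } =
      (fun μ => monomial μ (1 : K)) '' { μ | ∃ p ∈ I, IsLeadExp p μ } := by
    ext m
    constructor
    · rintro ⟨p, hp, -, μ, hμ, rfl⟩
      exact ⟨μ, ⟨p, hp, hμ⟩, rfl⟩
    · rintro ⟨μ, ⟨p, hp, hμ⟩, rfl⟩
      exact ⟨p, hp, support_nonempty.1 ⟨μ, hμ.1⟩, μ, hμ, rfl⟩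
  classical
  rw [initialIdeal, hset, mem_ideal_span_monomial_image, support_monomial, if_neg one_ne_zero]
  simp only [Finset.mem_singleton, forall_eq, Set.mem_ofPred_eq]
  exact ⟨fun ⟨μ, h, hle⟩ => ⟨μ, hle, h⟩, fun ⟨μ, hle, h⟩ => ⟨μ, h, hle⟩⟩

theorem IsLeadExp.homogeneousComponent {n : ℕ} {K : Type*} [CommSemiring K]
    {p : MvPolynomial (Fin n) K} {μ : Fin n →₀ ℕ} (h : IsLeadExp p μ) :
    IsLeadExp (homogeneousComponent (expDeg μ) p) μ := by
  refine ⟨?_, fun ν hν => h.2 ν ?_⟩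
  · rw [mem_support_iff, coeff_homogeneousComponent,
      if_pos (show Finsupp.degree μ = expDeg μ from rfl)]
    exact mem_support_iff.1 h.1
  · rw [mem_support_iff, coeff_homogeneousComponent] at hν
    rw [mem_support_iff]
    exact fun h0 => hν (by simp [h0])

theorem drlLT_single {n : ℕ} {i₀ : Fin n} (hi₀ : ∀ j, i₀ ≤ j) {κ : Fin n →₀ ℕ} {e : ℕ}
    (hκ : expDeg κ = e) (hne : κ ≠ Finsupp.single i₀ e) : DrlLT κ (Finsupp.single i₀ e) := by
  classical
  refine Or.inr ⟨by rw [hκ, expDeg_single], ?_⟩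
  have hex : ∃ j, i₀ < j ∧ κ j ≠ 0 := by
    by_contra! h
    have h1 : κ = Finsupp.single i₀ (κ i₀) := by
      ext j
      rcases (hi₀ j).eq_or_lt with rfl | hj
      · simp
      · rw [h j hj, Finsupp.single_eq_of_ne hj.ne']
    have h2 : κ i₀ = e := by rw [← hκ, h1, expDeg_single]; simp
    exact hne (h2 ▸ h1)
  obtain ⟨j, hj⟩ := hex
  let s := Finset.univ.filter fun j => i₀ < j ∧ κ j ≠ 0
  have hs : s.Nonempty := ⟨j, by simp [s, hj]⟩
  have hmax := s.max'_mem hs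
  simp only [s, Finset.mem_filter, Finset.mem_univ, true_and] at hmax
  refine ⟨s.max' hs, ?_, fun j hj => ?_⟩
  · rw [Finsupp.single_eq_of_ne hmax.1.ne']
    exact Nat.pos_of_ne_zero hmax.2
  · rw [Finsupp.single_eq_of_ne (hmax.1.trans hj).ne']
    by_contra h0
    exact absurd (s.le_max' j (by simp [s, hmax.1.trans hj, h0])) (not_le.2 hj)

/-- The powers of the first variable in the initial ideal of a generic ideal. -/
theorem monomial_single_mem_initialIdeal {F K : Type*} [Field F] [Field K] [Algebra F K]
    {n : ℕ} {d : Fin n → ℕ} {f : Fin n → MvPolynomial (Fin n) K} (hf : IsGenericSeq F d f)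
    {i₀ : Fin n} (hi₀ : ∀ j, i₀ ≤ j) {D : ℕ} (hD : d i₀ ≤ D) :
    monomial (Finsupp.single i₀ D) (1 : K) ∈ initialIdeal (Ideal.span (Set.range f)) := by
  refine monomial_mem_initialIdeal_iff.2 ⟨Finsupp.single i₀ (d i₀),
    Finsupp.single_mono hD, f i₀, Ideal.subset_span ⟨i₀, rfl⟩, ?_, fun κ hκ hne => ?_⟩
  · rw [mem_support_iff]
    exact hf.2.ne_zero ⟨i₀, ⟨Finsupp.single i₀ (d i₀), expDeg_single _ _⟩⟩
  · refine drlLT_single hi₀ ?_ hne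
    by_contra h
    exact mem_support_iff.1 hκ ((hf.1 i₀).coeff_eq_zero_of_expDeg_ne h)

/-- A minimal generator of the initial ideal is the leading exponent of a form in the ideal. -/
theorem IsMinGen.exists_isLeadExp {n r : ℕ} {K : Type*} [Field K] {d : Fin r → ℕ}
    {f : Fin r → MvPolynomial (Fin n) K} (hf : ∀ i, (f i).IsHomogeneous (d i))
    {μ : Fin n →₀ ℕ} (hμ : IsMinGen (initialIdeal (Ideal.span (Set.range f))) μ) :
    ∃ a : Fin r → MvPolynomial (Fin n) K, (∀ i, HomogAdd (expDeg μ) (d i) (a i)) ∧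
      HomogAdd (expDeg μ) 0 (∑ i, a i * f i) ∧ IsLeadExp (∑ i, a i * f i) μ := by
  obtain ⟨ν, hν, p, hp, hlead⟩ := monomial_mem_initialIdeal_iff.1 hμ.1
  obtain rfl : ν = μ := by
    by_contra hne
    exact hμ.2 ν hν hne (monomial_mem_initialIdeal_iff.2 ⟨ν, le_rfl, p, hp, hlead⟩)
  obtain ⟨a, ha, hsum⟩ := exists_homogAdd_of_mem_span hf hp (expDeg ν)
  refine ⟨a, ha, ?_, ?_⟩ <;> rw [← hsum]
  · exact (homogeneousComponent_isHomogeneous _ _).homogAdd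
  · exact hlead.homogeneousComponent

theorem le_expDeg_of_isMinGen {n r : ℕ} {K : Type*} [Field K] {d : Fin r → ℕ}
    {f : Fin r → MvPolynomial (Fin n) K} (hf : ∀ i, (f i).IsHomogeneous (d i))
    {μ : Fin n →₀ ℕ} (hμ : IsMinGen (initialIdeal (Ideal.span (Set.range f))) μ) :
    ∃ i, d i ≤ expDeg μ := by
  obtain ⟨a, ha, -, hlead⟩ := hμ.exists_isLeadExp hf
  by_contra! h
  have h0 : ∀ i, a i = 0 := fun i => by
    ext ν
    rw [ha i ν (by have := h i; omega), coeff_zero]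
  have := hlead.1
  simp [h0] at this

theorem IsLeadExp.of_X_mul {n : ℕ} {K : Type*} [CommSemiring K] {i : Fin n}
    {q : MvPolynomial (Fin n) K} {μ : Fin n →₀ ℕ}
    (h : IsLeadExp (X i * q) (Finsupp.single i 1 + μ)) : IsLeadExp q μ := by
  refine ⟨?_, fun ν hν hne => ?_⟩
  · rw [mem_support_iff, ← coeff_X_mul μ i q]
    exact mem_support_iff.1 h.1
  · have h1 := h.2 (Finsupp.single i 1 + ν) (by
      rw [mem_support_iff, coeff_X_mul]
      exact mem_support_iff.1 hν) (fun he => hne (add_left_cancel he))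
    simp only [DrlLT, expDeg_add, Finsupp.add_apply, add_lt_add_iff_left, add_right_inj] at h1
    exact h1

theorem coeff_eq_zero_of_X_dvd {n : ℕ} {K : Type*} [CommSemiring K] {i : Fin n}
    {p : MvPolynomial (Fin n) K} (h : X i ∣ p) {μ : Fin n →₀ ℕ} (hμ : μ i = 0) :
    p.coeff μ = 0 := by
  classical
  obtain ⟨q, rfl⟩ := h
  rw [coeff_X_mul', if_neg]
  simpa using hμ

/-- Property `P` at the last of three variables. -/
theorem monomial_mem_of_isMinGen_of_last_ne_zero {F K : Type*} [Field F] [Field K] [Algebra F K]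
    {d : Fin 3 → ℕ} {f : Fin 3 → MvPolynomial (Fin 3) K} (hf : IsGenericSeq F d f)
    {μ : Fin 3 →₀ ℕ} (hμ : IsMinGen (initialIdeal (Ideal.span (Set.range f))) μ) (h2 : μ 2 ≠ 0)
    {ν : Fin 3 →₀ ℕ} (hν : expDeg ν = expDeg μ) (hν2 : ν 2 = 0) :
    monomial ν (1 : K) ∈ initialIdeal (Ideal.span (Set.range f)) := by
  classical
  obtain ⟨a, -, hhom, hlead⟩ := hμ.exists_isLeadExp hf.1
  have hpI : ∑ i, a i * f i ∈ Ideal.span (Set.range f) :=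
    Ideal.sum_mem _ fun i _ => Ideal.mul_mem_left _ _ (Ideal.subset_span ⟨i, rfl⟩)
  have hX : X 2 ∣ ∑ i, a i * f i := by
    refine X_dvd_of_coeff_eq_zero fun κ hκ => ?_
    by_contra h0
    have hne : κ ≠ μ := fun h => h2 (h ▸ hκ)
    have hdeg : expDeg κ = expDeg μ := by
      by_contra hd
      exact h0 (hhom κ hd)
    rcases hlead.2 κ (mem_support_iff.2 h0) hne with hlt | ⟨-, i, hi, hj⟩
    · omega
    · by_cases hi2 : i = 2
      · subst hi2
        omega
      · exact h2 (by rw [← hj 2 (by omega), hκ])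
  obtain ⟨q, hq⟩ := hX
  rw [hq] at hhom hlead hpI
  obtain ⟨μ', rfl⟩ : ∃ μ', μ = Finsupp.single 2 1 + μ' :=
    le_iff_exists_add.1 (Finsupp.single_le_iff.2 (Nat.one_le_iff_ne_zero.2 h2))
  have hqI : q ∉ Ideal.span (Set.range f) := fun hqI =>
    hμ.2 μ' le_add_self (fun h => by simpa using DFunLike.congr_fun h 2)
      (monomial_mem_initialIdeal_iff.2 ⟨μ', le_rfl, q, hqI, hlead.of_X_mul⟩)
  rcases surjective_or_injective_of_isGenericSeq hf (expDeg (Finsupp.single 2 1 + μ')) with hs | hi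
  · obtain ⟨p, hpI, hp, hdvd⟩ := hs (monomial ν 1) (fun κ hκ => by
      rw [coeff_monomial, if_neg]
      rintro rfl
      exact hκ hν)
    have hcoeff : ∀ κ : Fin 3 →₀ ℕ, κ 2 = 0 → p.coeff κ = if ν = κ then 1 else 0 := by
      intro κ hκ
      have h := coeff_eq_zero_of_X_dvd hdvd hκ
      rw [coeff_sub, coeff_monomial, sub_eq_zero] at h
      exact h.symm
    refine monomial_mem_initialIdeal_iff.2 ⟨ν, le_rfl, p, hpI, ?_, fun κ hκ hne => ?_⟩
    · rw [mem_support_iff, hcoeff ν hν2]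
      simp
    · rw [mem_support_iff] at hκ
      refine Or.inr ⟨?_, 2, ?_, fun j hj => absurd hj (by omega)⟩
      · by_contra hd
        exact hκ (hp κ (by rw [← hν]; exact hd))
      · rw [hν2]
        refine Nat.pos_of_ne_zero fun h => hκ ?_
        rw [hcoeff κ h, if_neg hne.symm]
  · exact absurd (hi q hhom hpI) hqI

/-- Conjecture E holds for every generic ideal of type `(n; d_1,…,d_n)` with
`n ≤ 3` and `d_1 ≤ ⋯ ≤ d_n`. -/
theorem stmt15 {F K : Type*} [Field F] [Field K] [Algebra F K] [Infinite K]
    {n : ℕ} (hn3 : n ≤ 3) (d : Fin n → ℕ) (hd : ∀ i, 1 ≤ d i) (hmono : Monotone d)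
    (f : Fin n → MvPolynomial (Fin n) K) (hf : IsGenericSeq F d f)
    (I : Ideal (MvPolynomial (Fin n) K)) (hI : I = Ideal.span (Set.range f)) :
    ConjE I := by
  subst hI
  intro μ hμ m hm hmax ν hν hνm
  have hn : 0 < n := m.pos
  have hi₀ : ∀ j : Fin n, (⟨0, hn⟩ : Fin n) ≤ j := fun j => Nat.zero_le _
  by_cases hm2 : m.val < 2
  · obtain ⟨i, hi⟩ := le_expDeg_of_isMinGen hf.1 hμ
    have hmem := monomial_single_mem_initialIdeal hf hi₀ ((hmono (hi₀ i)).trans hi)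
    have hν0 : ν = Finsupp.single ⟨0, hn⟩ (ν ⟨0, hn⟩) := by
      ext j
      by_cases hj : j = ⟨0, hn⟩
      · subst hj
        simp
      · rw [Finsupp.single_eq_of_ne hj]
        refine hνm j ?_
        rw [Fin.ext_iff] at hj
        rw [Fin.le_def]
        have : j.val ≠ 0 := hj
        omega
    have hνe : ν ⟨0, hn⟩ = expDeg μ := by
      rw [← hν, hν0, expDeg_single]
      simp
    rwa [hν0, hνe]
  · obtain rfl : n = 3 := by omega
    obtain rfl : m = 2 := by omega
    exact monomial_mem_of_isMinGen_of_last_ne_zero hf hμ hm hν (hνm 2 le_rfl)
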